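/- Let 0 < α < 1. There exists a constant c > 0, depending only on α, with the following property. Let V be a nontrivial finite-dimensional complex inner product space, A : V → V a self-adjoint positive definite linear operator, τ > 0, N ≥ 1, and σ^1, …, σ^N ∈ V. Let e^0 = 0 and, for 1 ≤ n ≤ N, let e^n ∈ V solve ∂̄_τ^α e^n + A e^n = σ^n. Then for every 1 ≤ n ≤ N, τ Σ_{j=1}^n (t_{n+1} - t_j)^{α/2 - 1} |∂̄_τ^α e^j| ≤ c · τ · ℓ_n · Σ_{j=1}^n (t_{n+1} - t_j)^{α/2 - 1} ‖(I + τ^α A)^{-1/2} σ^j‖, where t_k = kτ, ℓ_n = ln(1 + n), |ψ| = ‖(I + τ^α A)^{1/2} ψ‖, and ∂̄_τ^α e^j = τ^{-α} Σ_{ℓ=0}^j b_ℓ^{(α)} e^{j-ℓ}. -/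

import Mathlib

open scoped ComplexInnerProductSpace

/-- The backward Euler convolution quadrature weights `b_ℓ^(α) = (-1)^ℓ binom(α, ℓ)`. -/
noncomputable def cqWeight (α : ℝ) (ℓ : ℕ) : ℝ :=
  (-1 : ℝ) ^ ℓ * (∏ i ∈ Finset.range ℓ, (α - i)) / (Nat.factorial ℓ)

/-- The backward Euler CQ approximation `∂̄_τ^α e^n = τ^{-α} Σ_{ℓ=0}^n b_ℓ^(α) e^{n-ℓ}`. -/
noncomputable def cqDeriv (α : ℝ) {V : Type} [AddCommGroup V] [Module ℝ V]
    (τ : ℝ) (e : ℕ → V) (n : ℕ) : V :=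
  τ ^ (-α) • ∑ ℓ ∈ Finset.range (n + 1), cqWeight α ℓ • e (n - ℓ)

/-- The power `(I + τ^α A)^s` of the shifted operator, via the functional (spectral)
calculus. -/
noncomputable def shiftPow {V : Type} [NormedAddCommGroup V] [InnerProductSpace ℂ V]
    [FiniteDimensional ℂ V] (A : V →L[ℂ] V) (τ α s : ℝ) : V →L[ℂ] V :=
  cfc (fun x : ℝ => (1 + τ ^ α * x) ^ s) A

section ConvolutionQuadrature

open Finset PowerSeries

theorem Finset.Nat.sum_antidiagonal_fst_snd {M : Type*} [AddCommMonoid M]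
    (f : ℕ → ℕ → ℕ → M) (n : ℕ) :
    ∑ p ∈ antidiagonal n, ∑ q ∈ antidiagonal p.2, f p.1 q.1 q.2 =
      ∑ p ∈ antidiagonal n, ∑ q ∈ antidiagonal p.1, f q.1 q.2 p.2 := by
  rw [Finset.sum_sigma', Finset.sum_sigma']
  refine Finset.sum_nbij' (fun x => ⟨(x.1.1 + x.2.1, x.2.2), (x.1.1, x.2.1)⟩)
    (fun x => ⟨(x.2.1, x.2.2 + x.1.2), (x.2.2, x.1.2)⟩) ?_ ?_ ?_ ?_ fun _ _ => rfl <;>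
  · rintro ⟨⟨a, b⟩, ⟨c, d⟩⟩ h
    simp only [mem_sigma, HasAntidiagonal.mem_antidiagonal] at h ⊢
    obtain ⟨h1, h2⟩ := h
    subst h2
    first
      | rfl
      | exact ⟨by omega, trivial⟩

/-- Kaluza's theorem: the reciprocal of a power series with positive logarithmically convex
coefficients has nonpositive coefficients, apart from the constant one. -/
theorem nonpos_of_logConvex_of_convolution_eq_zero {u v : ℕ → ℝ} (hu : ∀ n, 0 < u n)
    (hlog : ∀ n, u (n + 1) * u (n + 1) ≤ u n * u (n + 2)) (hv0 : 0 ≤ v 0)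
    (huv : ∀ n, ∑ p ∈ antidiagonal (n + 1), u p.1 * v p.2 = 0) (n : ℕ) : v (n + 1) ≤ 0 := by
  have hmono : Monotone fun n => u (n + 1) / u n := by
    refine monotone_nat_of_le_succ fun n => ?_
    rw [div_le_div_iff₀ (hu _) (hu _)]
    linarith [hlog n, mul_comm (u n) (u (n + 2))]
  induction n using Nat.strong_induction_on with
  | _ n ih =>
    have h1 := huv n
    rw [Nat.sum_antidiagonal_succ] at h1
    have hkey : 0 ≤ ∑ p ∈ antidiagonal n, u (p.1 + 1) * v p.2 := by
      cases n with
      | zero => simpa using mul_nonneg (hu 1).le hv0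
      | succ m =>
        have h2 : u (m + 2) / u (m + 1) * ∑ p ∈ antidiagonal (m + 1), u p.1 * v p.2 = 0 := by
          rw [huv m, mul_zero]
        rw [← h2, mul_sum]
        refine sum_le_sum fun p hp => ?_
        obtain ⟨i, j⟩ := p
        rw [HasAntidiagonal.mem_antidiagonal] at hp
        simp only at hp ⊢
        have h3 : u (i + 1) = u (i + 1) / u i * u i := (div_mul_cancel₀ _ (hu i).ne').symm
        rw [h3, mul_assoc]
        rcases j with _ | j
        · simp only [add_zero] at hp
          subst hp
          exact le_rfl
        · have hv : v (j + 1) ≤ 0 := ih j (by omega)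
          have h4 : u (i + 1) / u i ≤ u (m + 2) / u (m + 1) := hmono (show i ≤ m + 1 by omega)
          exact mul_le_mul_of_nonpos_right h4 (mul_nonpos_of_nonneg_of_nonpos (hu i).le hv)
    have h5 : u 0 * v (n + 1) ≤ 0 := by linarith
    exact nonpos_of_mul_nonpos_right h5 (hu 0)

theorem cqWeight_zero (α : ℝ) : cqWeight α 0 = 1 := by simp [cqWeight]

theorem cqWeight_succ_eq_sum (α : ℝ) (n : ℕ) :
    cqWeight α (n + 1) = -α / (n + 1) * ∑ l ∈ range (n + 1), cqWeight α l := by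
  have hrec : ∀ n : ℕ, cqWeight α (n + 1) = cqWeight α n * ((n - α) / (n + 1)) := by
    intro n
    have : (n.factorial : ℝ) ≠ 0 := by positivity
    have : (n : ℝ) + 1 ≠ 0 := by positivity
    simp only [cqWeight, prod_range_succ, pow_succ, Nat.factorial_succ]
    push_cast
    field_simp
    ring
  induction n with
  | zero => simp [hrec 0, cqWeight_zero]
  | succ n ih =>
    have : (n : ℝ) + 1 ≠ 0 := by positivity
    have : (n : ℝ) + 1 + 1 ≠ 0 := by positivity
    rw [hrec (n + 1), sum_range_succ, ih]
    push_cast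
    field_simp
    ring

/-- The partial sums of the convolution quadrature weights. -/
noncomputable def cqWeightSum (α : ℝ) (n : ℕ) : ℝ := ∑ l ∈ range (n + 1), cqWeight α l

theorem cqWeightSum_zero (α : ℝ) : cqWeightSum α 0 = 1 := by
  simp [cqWeightSum, cqWeight_zero]

theorem cqWeightSum_succ (α : ℝ) (n : ℕ) :
    cqWeightSum α (n + 1) = (1 - α / (n + 1)) * cqWeightSum α n := by
  unfold cqWeightSum
  rw [sum_range_succ, cqWeight_succ_eq_sum]
  ring

theorem cqWeightSum_pos {α : ℝ} (hα1 : α < 1) (n : ℕ) : 0 < cqWeightSum α n := by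
  induction n with
  | zero => simp [cqWeightSum_zero]
  | succ n ih =>
    rw [cqWeightSum_succ]
    refine mul_pos ?_ ih
    rw [sub_pos, div_lt_one (by positivity)]
    linarith [(Nat.cast_nonneg n : (0 : ℝ) ≤ n)]

theorem cqWeightSum_succ_le {α : ℝ} (hα0 : 0 < α) (hα1 : α < 1) (n : ℕ) :
    cqWeightSum α (n + 1) ≤ cqWeightSum α n := by
  rw [cqWeightSum_succ]
  have h1 := cqWeightSum_pos hα1 n
  have h2 : 0 ≤ α / ((n : ℝ) + 1) := by positivity
  nlinarith

theorem cqWeightSum_logConvex {α l : ℝ} (hα0 : 0 < α) (hα1 : α < 1) (hl : 0 ≤ l) (n : ℕ) :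
    (cqWeightSum α (n + 1) + l) * (cqWeightSum α (n + 1) + l) ≤
      (cqWeightSum α n + l) * (cqWeightSum α (n + 2) + l) := by
  have hc := cqWeightSum_pos hα1 n
  have hc1 := cqWeightSum_pos hα1 (n + 1)
  have hle := cqWeightSum_succ_le hα0 hα1 n
  have e1 := cqWeightSum_succ α n
  have e2 := cqWeightSum_succ α (n + 1)
  have hq : α / ((n + 1 : ℕ) + 1 : ℝ) ≤ α / (n + 1) := by
    push_cast
    gcongr
    linarith
  have hq0 : 0 ≤ α / ((n + 1 : ℕ) + 1 : ℝ) := by positivity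
  generalize α / ((n + 1 : ℕ) + 1 : ℝ) = q' at *
  generalize α / ((n : ℝ) + 1) = q at *
  have h1 : cqWeightSum α (n + 1) * cqWeightSum α (n + 1) ≤
      cqWeightSum α n * cqWeightSum α (n + 2) := by
    rw [e2]
    nth_rewrite 1 [e1]
    nlinarith [mul_le_mul_of_nonneg_right hq (mul_pos hc hc1).le]
  have h2 : 2 * cqWeightSum α (n + 1) ≤ cqWeightSum α n + cqWeightSum α (n + 2) := by
    nlinarith [mul_le_mul hq hle hc1.le (hq0.trans hq)]
  nlinarith

/-- The symbol `(1 - ξ)^α + l` of the scalar convolution quadrature equation. -/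
noncomputable def cqSymbol (α l : ℝ) : PowerSeries ℝ := PowerSeries.mk (cqWeight α) + C l

/-- The fundamental solution of the scalar convolution quadrature equation. -/
noncomputable def cqResolvent (α : ℝ) (n : ℕ) (l : ℝ) : ℝ := coeff n (cqSymbol α l)⁻¹

theorem constantCoeff_cqSymbol (α l : ℝ) : constantCoeff (cqSymbol α l) = 1 + l := by
  rw [← coeff_zero_eq_constantCoeff_apply, cqSymbol, map_add, coeff_mk, cqWeight_zero]
  simp

theorem cqResolvent_mul_cqSymbol (α : ℝ) {l : ℝ} (hl : 0 ≤ l) (n : ℕ) :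
    ∑ p ∈ antidiagonal n, cqResolvent α p.1 l * coeff p.2 (cqSymbol α l) =
      if n = 0 then 1 else 0 := by
  have h : (cqSymbol α l)⁻¹ * cqSymbol α l = 1 :=
    PowerSeries.inv_mul_cancel _ (by rw [constantCoeff_cqSymbol]; positivity)
  have h2 := congrArg (coeff n) h
  rwa [coeff_mul, coeff_one] at h2

theorem cqSymbol_mul_mk_one (α l : ℝ) :
    cqSymbol α l * PowerSeries.mk 1 = PowerSeries.mk fun n => cqWeightSum α n + l := by
  ext n
  rw [cqSymbol, add_mul, map_add, coeff_C_mul, coeff_mul,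
    Nat.sum_antidiagonal_eq_sum_range_succ_mk]
  simp [cqWeightSum]

theorem sum_cqResolvent_mul (α : ℝ) {l : ℝ} (hl : 0 ≤ l) (n : ℕ) :
    ∑ p ∈ antidiagonal n, cqResolvent α p.1 l * (cqWeightSum α p.2 + l) = 1 := by
  have h : (cqSymbol α l)⁻¹ * cqSymbol α l = 1 :=
    PowerSeries.inv_mul_cancel _ (by rw [constantCoeff_cqSymbol]; positivity)
  have h2 := congrArg (fun x => coeff n (x * PowerSeries.mk 1)) h
  simp only [mul_assoc, cqSymbol_mul_mk_one, one_mul, coeff_mk, Pi.one_apply] at h2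
  rw [coeff_mul] at h2
  simp only [coeff_mk] at h2
  exact h2

theorem cqResolvent_zero (α : ℝ) (l : ℝ) : cqResolvent α 0 l = (1 + l)⁻¹ := by
  rw [cqResolvent, coeff_inv, if_pos rfl, constantCoeff_cqSymbol]

theorem cqResolvent_nonneg {α l : ℝ} (hα0 : 0 < α) (hα1 : α < 1) (hl : 0 ≤ l) (n : ℕ) :
    0 ≤ cqResolvent α n l := by
  induction n using Nat.strong_induction_on with
  | _ n ih =>
    cases n with
    | zero =>
      rw [cqResolvent_zero]
      positivity
    | succ n =>
      have h1 := sum_cqResolvent_mul α hl (n + 1)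
      rw [Nat.sum_antidiagonal_succ', cqWeightSum_zero] at h1
      have h2 : ∑ p ∈ antidiagonal n, cqResolvent α p.1 l * (cqWeightSum α (p.2 + 1) + l) ≤
          ∑ p ∈ antidiagonal n, cqResolvent α p.1 l * (cqWeightSum α p.2 + l) := by
        refine sum_le_sum fun p hp => mul_le_mul_of_nonneg_left ?_ (ih _ ?_)
        · linarith [cqWeightSum_succ_le hα0 hα1 p.2]
        · have := HasAntidiagonal.mem_antidiagonal.mp hp
          omega
      rw [sum_cqResolvent_mul α hl n] at h2
      exact nonneg_of_mul_nonneg_left (by linarith) (show 0 < 1 + l by positivity)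

theorem mul_sum_cqResolvent_le_one {α l : ℝ} (hα0 : 0 < α) (hα1 : α < 1) (hl : 0 ≤ l) (n : ℕ) :
    l * ∑ k ∈ range (n + 1), cqResolvent α k l ≤ 1 := by
  rw [← sum_cqResolvent_mul α hl n, Nat.sum_antidiagonal_eq_sum_range_succ_mk, mul_sum]
  refine sum_le_sum fun k _ => ?_
  rw [mul_comm]
  refine mul_le_mul_of_nonneg_left ?_ (cqResolvent_nonneg hα0 hα1 hl k)
  linarith [cqWeightSum_pos hα1 (n - k)]

theorem cqResolvent_succ_le {α l : ℝ} (hα0 : 0 < α) (hα1 : α < 1) (hl : 0 ≤ l) (n : ℕ) :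
    cqResolvent α (n + 1) l ≤ cqResolvent α n l := by
  have key := nonpos_of_logConvex_of_convolution_eq_zero
    (u := fun n => cqWeightSum α n + l) (v := fun n => coeff n ((cqSymbol α l)⁻¹ * (1 - X)))
    (fun n => by linarith [cqWeightSum_pos hα1 n])
    (cqWeightSum_logConvex hα0 hα1 hl) ?_ (fun n => ?_) n
  · rw [mul_sub, mul_one, map_sub, coeff_succ_mul_X] at key
    exact sub_nonpos.mp key
  · rw [mul_sub, mul_one, map_sub, coeff_zero_mul_X, sub_zero]
    exact cqResolvent_nonneg hα0 hα1 hl 0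
  · have h : (PowerSeries.mk fun n => cqWeightSum α n + l) * ((cqSymbol α l)⁻¹ * (1 - X)) = 1 := by
      rw [← cqSymbol_mul_mk_one]
      calc _ = (cqSymbol α l * (cqSymbol α l)⁻¹) * (PowerSeries.mk 1 * (1 - X)) := by ring
        _ = 1 := by
          rw [PowerSeries.mul_inv_cancel _ (by rw [constantCoeff_cqSymbol]; positivity),
            mk_one_mul_one_sub_eq_one, mul_one]
    have h2 := congrArg (coeff (n + 1)) h
    rw [coeff_mul, coeff_one, if_neg (Nat.succ_ne_zero n)] at h2
    simpa only [coeff_mk] using h2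

theorem continuousOn_cqResolvent (α : ℝ) (n : ℕ) :
    ContinuousOn (cqResolvent α n) (Set.Ici 0) := by
  have hinv : ContinuousOn (fun l : ℝ => (1 + l)⁻¹) (Set.Ici 0) :=
    ContinuousOn.inv₀ (by fun_prop) fun l (hl : 0 ≤ l) => by positivity
  induction n using Nat.strong_induction_on with
  | _ n ih =>
    have hrec : cqResolvent α n = fun l => if n = 0 then (1 + l)⁻¹ else -(1 + l)⁻¹ *
        ∑ p ∈ antidiagonal n,
          if p.2 < n then coeff p.1 (cqSymbol α l) * cqResolvent α p.2 l else 0 := by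
      funext l
      rw [cqResolvent, coeff_inv, constantCoeff_cqSymbol]
      rfl
    rw [hrec]
    split_ifs with h
    · exact hinv
    · refine hinv.neg.mul (continuousOn_finsetSum _ fun p _ => ?_)
      split_ifs with hp
      · refine ContinuousOn.mul ?_ (ih _ hp)
        simp only [cqSymbol, map_add, coeff_mk, coeff_C]
        split_ifs <;> fun_prop
      · exact continuousOn_const

/-- The multiplier `(1 + l) (δ_{n0} - l r_n(l))`, where `r` is the fundamental solution. -/
noncomputable def cqMultiplier (α : ℝ) (n : ℕ) (l : ℝ) : ℝ :=
  (1 + l) * ((if n = 0 then 1 else 0) - l * cqResolvent α n l)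

/-- The sequence `1, 1, 1 / 2, 1 / 3, …`. -/
noncomputable def cqMajorant (n : ℕ) : ℝ := (if n = 0 then 1 else 0) + (n : ℝ)⁻¹

theorem cqMajorant_nonneg (n : ℕ) : 0 ≤ cqMajorant n := by
  unfold cqMajorant
  split_ifs <;> positivity

theorem abs_cqMultiplier_le {α l : ℝ} (hα0 : 0 < α) (hα1 : α < 1) (hl : 0 ≤ l) (n : ℕ) :
    |cqMultiplier α n l| ≤ cqMajorant n := by
  have hl1 : (0 : ℝ) < 1 + l := by positivity
  rcases n with _ | n
  · rw [cqMultiplier, cqResolvent_zero]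
    have : (1 + l) * (1 - l * (1 + l)⁻¹) = 1 := by
      field_simp
      ring
    simp [this, cqMajorant]
  · have hr := cqResolvent_nonneg hα0 hα1 hl (n + 1)
    have hanti : Antitone fun n => cqResolvent α n l :=
      antitone_nat_of_succ_le (cqResolvent_succ_le hα0 hα1 hl)
    have hsum := mul_sum_cqResolvent_le_one hα0 hα1 hl (n + 1)
    rw [sum_range_succ', cqResolvent_zero] at hsum
    have hge : ((n : ℝ) + 1) * cqResolvent α (n + 1) l ≤
        ∑ k ∈ range (n + 1), cqResolvent α (k + 1) l := by
      have := card_nsmul_le_sum (range (n + 1)) (fun k => cqResolvent α (k + 1) l)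
        (cqResolvent α (n + 1) l) fun k hk => hanti (by rw [mem_range] at hk; omega)
      simpa using this
    have h1 : l * (((n : ℝ) + 1) * cqResolvent α (n + 1) l) ≤ 1 - l * (1 + l)⁻¹ := by
      linarith [mul_le_mul_of_nonneg_left hge hl]
    have h2 : 1 - l * (1 + l)⁻¹ = (1 + l)⁻¹ := by
      field_simp
      ring
    rw [h2] at h1
    have h3 : (1 + l) * (l * (((n : ℝ) + 1) * cqResolvent α (n + 1) l)) ≤ 1 := by
      calc _ ≤ (1 + l) * (1 + l)⁻¹ := by gcongr
        _ = 1 := mul_inv_cancel₀ hl1.ne'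
    simp only [cqMultiplier, cqMajorant, if_neg (Nat.succ_ne_zero n), zero_sub, zero_add, mul_neg,
      abs_neg]
    rw [abs_of_nonneg (by positivity), inv_eq_one_div, le_div_iff₀ (by positivity)]
    push_cast
    linarith

section Operator

variable {V : Type} [NormedAddCommGroup V] [InnerProductSpace ℂ V] [FiniteDimensional ℂ V]

/-- The convolution quadrature resolvent of a positive operator inverts the scheme. -/
theorem eq_sum_cfc_cqResolvent {A : V →L[ℂ] V} (hA : 0 ≤ A) (α : ℝ) {τ : ℝ} (hτ : 0 < τ)
    (e : ℕ → V) (n : ℕ) :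
    e n = τ ^ α • ∑ p ∈ antidiagonal n, cfc (fun x => cqResolvent α p.1 (τ ^ α * x)) A
      (cqDeriv α τ e p.2 + A (e p.2)) := by
  have hsa : IsSelfAdjoint A := hA.isSelfAdjoint
  have hspec : ∀ x ∈ spectrum ℝ A, 0 ≤ τ ^ α * x := fun x hx =>
    mul_nonneg (by positivity) (spectrum_nonneg_of_nonneg hA hx)
  have hRc : ∀ i, ContinuousOn (fun x => cqResolvent α i (τ ^ α * x)) (spectrum ℝ A) := fun i =>
    (continuousOn_cqResolvent α i).comp (by fun_prop) hspec
  have hWc : ∀ l, ContinuousOn (fun x => coeff l (cqSymbol α (τ ^ α * x))) (spectrum ℝ A) := by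
    intro l
    simp only [cqSymbol, map_add, coeff_mk, coeff_C]
    split_ifs <;> fun_prop
  have hW : ∀ l v, cfc (fun x => coeff l (cqSymbol α (τ ^ α * x))) A v =
      cqWeight α l • v + if l = 0 then τ ^ α • A v else 0 := by
    intro l v
    simp only [cqSymbol, map_add, coeff_mk, coeff_C]
    split_ifs with h
    · rw [cfc_add .., cfc_const .., cfc_const_mul .., cfc_id' ..]
      simp [Algebra.algebraMap_eq_smul_one]
    · simp only [add_zero]
      rw [cfc_const ..]
      simp [Algebra.algebraMap_eq_smul_one]
  have hscheme : ∀ j, τ ^ α • (cqDeriv α τ e j + A (e j)) =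
      ∑ q ∈ antidiagonal j, cfc (fun x => coeff q.1 (cqSymbol α (τ ^ α * x))) A (e q.2) := by
    intro j
    simp only [hW, sum_add_distrib, smul_add]
    congr 1
    · rw [cqDeriv, smul_smul, ← Real.rpow_add hτ, add_neg_cancel, Real.rpow_zero, one_smul,
        Nat.sum_antidiagonal_eq_sum_range_succ_mk]
    · rw [Nat.sum_antidiagonal_eq_sum_range_succ_mk]
      simp
  have hRW : ∀ k, ∑ q ∈ antidiagonal k, cfc (fun x => cqResolvent α q.1 (τ ^ α * x)) A *
      cfc (fun x => coeff q.2 (cqSymbol α (τ ^ α * x))) A = if k = 0 then 1 else 0 := by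
    intro k
    have h1 : ∀ q ∈ antidiagonal k, cfc (fun x => cqResolvent α q.1 (τ ^ α * x)) A *
        cfc (fun x => coeff q.2 (cqSymbol α (τ ^ α * x))) A =
        cfc (fun x => cqResolvent α q.1 (τ ^ α * x) * coeff q.2 (cqSymbol α (τ ^ α * x))) A :=
      fun q _ => (cfc_mul _ _ A (hRc _) (hWc _)).symm
    rw [sum_congr rfl h1, ← cfc_sum (fun (q : ℕ × ℕ) x => cqResolvent α q.1 (τ ^ α * x) * coeff q.2 (cqSymbol α (τ ^ α * x)))
      A _ fun q _ => (hRc q.1).mul (hWc q.2)]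
    have h2 : Set.EqOn (∑ q ∈ antidiagonal k, fun x =>
        cqResolvent α q.1 (τ ^ α * x) * coeff q.2 (cqSymbol α (τ ^ α * x)))
        (fun _ => if k = 0 then 1 else 0) (spectrum ℝ A) := by
      intro x hx
      simpa using cqResolvent_mul_cqSymbol α (hspec x hx) k
    rw [cfc_congr h2, cfc_const ..]
    split_ifs <;> simp
  symm
  calc _ = ∑ p ∈ antidiagonal n, ∑ q ∈ antidiagonal p.2,
        (cfc (fun x => cqResolvent α p.1 (τ ^ α * x)) A *
          cfc (fun x => coeff q.1 (cqSymbol α (τ ^ α * x))) A) (e q.2) := by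
        rw [smul_sum]
        refine sum_congr rfl fun p _ => ?_
        rw [← ContinuousLinearMap.map_smul_of_tower, hscheme, map_sum]
        rfl
    _ = ∑ p ∈ antidiagonal n, (∑ q ∈ antidiagonal p.1,
        cfc (fun x => cqResolvent α q.1 (τ ^ α * x)) A *
          cfc (fun x => coeff q.2 (cqSymbol α (τ ^ α * x))) A) (e p.2) := by
        rw [Nat.sum_antidiagonal_fst_snd fun i l m =>
          (cfc (fun x => cqResolvent α i (τ ^ α * x)) A *
            cfc (fun x => coeff l (cqSymbol α (τ ^ α * x))) A) (e m)]
        simp only [_root_.sum_apply]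
    _ = e n := by
        simp only [hRW]
        rw [Nat.sum_antidiagonal_eq_sum_range_succ_mk, sum_range_succ']
        simp

theorem shiftPow_cqDeriv_eq_sum {A : V →L[ℂ] V} (hA : 0 ≤ A) (α : ℝ) {τ : ℝ} (hτ : 0 < τ)
    (e : ℕ → V) (n : ℕ) :
    shiftPow A τ α (1 / 2) (cqDeriv α τ e n) =
      ∑ p ∈ antidiagonal n, cfc (fun x => cqMultiplier α p.1 (τ ^ α * x)) A
        (shiftPow A τ α (-(1 / 2)) (cqDeriv α τ e p.2 + A (e p.2))) := by
  have hsa : IsSelfAdjoint A := hA.isSelfAdjoint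
  have hspec : ∀ x ∈ spectrum ℝ A, 0 ≤ τ ^ α * x := fun x hx =>
    mul_nonneg (by positivity) (spectrum_nonneg_of_nonneg hA hx)
  have hRc : ∀ i, ContinuousOn (fun x => cqResolvent α i (τ ^ α * x)) (spectrum ℝ A) := fun i =>
    (continuousOn_cqResolvent α i).comp (by fun_prop) hspec
  have hPc : ∀ s : ℝ, ContinuousOn (fun x => (1 + τ ^ α * x) ^ s) (spectrum ℝ A) := fun s =>
    ContinuousOn.rpow_const (by fun_prop) fun x hx => Or.inl (by linarith [hspec x hx])
  have hMc : ∀ i, ContinuousOn (fun x => cqMultiplier α i (τ ^ α * x)) (spectrum ℝ A) := by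
    intro i
    have := hRc i
    unfold cqMultiplier
    fun_prop
  have hM : ∀ i v, cfc (fun x => cqMultiplier α i (τ ^ α * x)) A
      (shiftPow A τ α (-(1 / 2)) v) = shiftPow A τ α (1 / 2) ((if i = 0 then v else 0) -
        τ ^ α • A (cfc (fun x => cqResolvent α i (τ ^ α * x)) A v)) := by
    intro i v
    have hR := hRc i
    have hc : ContinuousOn (fun x => (if i = 0 then 1 else 0) -
        τ ^ α * (x * cqResolvent α i (τ ^ α * x))) (spectrum ℝ A) := by fun_prop
    have h1 : cfc (fun x => cqMultiplier α i (τ ^ α * x)) A * shiftPow A τ α (-(1 / 2)) =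
        shiftPow A τ α (1 / 2) * cfc (fun x => (if i = 0 then 1 else 0) -
        τ ^ α * (x * cqResolvent α i (τ ^ α * x))) A := by
      unfold shiftPow
      rw [← cfc_mul _ _ A (hMc i) (hPc _), ← cfc_mul _ _ A (hPc _) hc]
      refine cfc_congr fun x hx => ?_
      have hpos : 0 < 1 + τ ^ α * x := by linarith [hspec x hx]
      have h2 : (1 + τ ^ α * x) * (1 + τ ^ α * x) ^ (-(1 / 2) : ℝ) =
          (1 + τ ^ α * x) ^ (1 / 2 : ℝ) := by
        nth_rewrite 1 [← Real.rpow_one (1 + τ ^ α * x)]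
        rw [← Real.rpow_add hpos]
        norm_num
      simp only [cqMultiplier]
      rw [← h2]
      ring
    have h3 : cfc (fun x => (if i = 0 then 1 else 0) -
        τ ^ α * (x * cqResolvent α i (τ ^ α * x))) A = (if i = 0 then 1 else 0) -
        τ ^ α • (A * cfc (fun x => cqResolvent α i (τ ^ α * x)) A) := by
      rw [cfc_sub .., cfc_const .., cfc_const_mul .., cfc_mul .., cfc_id' ..]
      split_ifs <;> simp
    have h4 := congrArg (fun T : V →L[ℂ] V => T v) h1
    rw [h3] at h4
    refine h4.trans ?_
    refine congrArg (shiftPow A τ α (1 / 2)) ?_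
    split_ifs <;> simp
  simp only [hM]
  rw [← map_sum]
  congr 1
  have hAe : A (e n) = ∑ p ∈ antidiagonal n, τ ^ α •
      A (cfc (fun x => cqResolvent α p.1 (τ ^ α * x)) A (cqDeriv α τ e p.2 + A (e p.2))) := by
    nth_rewrite 1 [eq_sum_cfc_cqResolvent hA α hτ e n]
    rw [ContinuousLinearMap.map_smul_of_tower, map_sum, smul_sum]
  rw [sum_sub_distrib, ← hAe, Nat.sum_antidiagonal_eq_sum_range_succ_mk, sum_range_succ']
  simp

theorem norm_shiftPow_cqDeriv_le {A : V →L[ℂ] V} (hA : 0 ≤ A) {α τ : ℝ} (hα0 : 0 < α)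
    (hα1 : α < 1) (hτ : 0 < τ) (e : ℕ → V) (n : ℕ) :
    ‖shiftPow A τ α (1 / 2) (cqDeriv α τ e n)‖ ≤ ∑ p ∈ antidiagonal n, cqMajorant p.1 *
      ‖shiftPow A τ α (-(1 / 2)) (cqDeriv α τ e p.2 + A (e p.2))‖ := by
  rw [shiftPow_cqDeriv_eq_sum hA α hτ]
  refine norm_sum_le_of_le _ fun p _ => ContinuousLinearMap.le_of_opNorm_le _ ?_ _
  refine norm_cfc_le (cqMajorant_nonneg _) fun x hx => abs_cqMultiplier_le hα0 hα1 ?_ _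
  exact mul_nonneg (by positivity) (spectrum_nonneg_of_nonneg hA hx)

end Operator

theorem rpow_neg_mul_inv_le {β x y : ℝ} (hβ0 : 0 ≤ β) (hβ1 : β ≤ 1) (hx : 0 < x) (hy : 0 < y) :
    x ^ (-β) * y⁻¹ ≤ (x + y) ^ (-β) * (2 * y⁻¹ + x⁻¹) := by
  have hamgm : (y⁻¹) ^ (1 - β) * (x⁻¹) ^ β ≤ (1 - β) * y⁻¹ + β * x⁻¹ :=
    Real.geom_mean_le_arith_mean2_weighted (by linarith) hβ0 (by positivity) (by positivity)
      (by ring)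
  have hsub := Real.rpow_add_le_add_rpow hx.le hy.le hβ0 hβ1
  have e1 : x ^ (-β) * y⁻¹ * (x ^ β + y ^ β) = y⁻¹ + (y⁻¹) ^ (1 - β) * (x⁻¹) ^ β := by
    rw [Real.rpow_sub (by positivity), Real.rpow_one, Real.inv_rpow hx.le, Real.inv_rpow hy.le,
      Real.rpow_neg hx.le]
    have := (Real.rpow_pos_of_pos hx β).ne'
    have := (Real.rpow_pos_of_pos hy β).ne'
    field_simp
  have hy' : 0 < y⁻¹ := by positivity
  have hx' : 0 < x⁻¹ := by positivity
  have h1 : x ^ (-β) * y⁻¹ * (x + y) ^ β ≤ 2 * y⁻¹ + x⁻¹ := by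
    calc _ ≤ x ^ (-β) * y⁻¹ * (x ^ β + y ^ β) := by gcongr
      _ ≤ _ := by
        rw [e1]
        nlinarith
  have hxy : 0 < x + y := by positivity
  rw [Real.rpow_neg hxy.le, inv_mul_eq_div, le_div_iff₀ (by positivity)]
  exact h1

theorem sum_rpow_mul_cqMajorant_le {β : ℝ} (hβ0 : 0 ≤ β) (hβ1 : β ≤ 1) (m : ℕ) :
    ∑ p ∈ antidiagonal m, ((p.1 : ℝ) + 1) ^ (-β) * cqMajorant p.2 ≤
      (4 + 3 * Real.log (m + 1)) * ((m : ℝ) + 1) ^ (-β) := by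
  have hharm : ∀ k : ℕ, ∑ i ∈ range k, ((i : ℝ) + 1)⁻¹ ≤ 1 + Real.log k := fun k => by
    simpa [harmonic] using harmonic_le_one_add_log k
  have hpt : ∀ p ∈ antidiagonal m, ((p.1 : ℝ) + 1) ^ (-β) * cqMajorant p.2 ≤
      ((m : ℝ) + 1) ^ (-β) *
        ((if p.2 = 0 then 1 else 0) + 2 * (p.2 : ℝ)⁻¹ + ((p.1 : ℝ) + 1)⁻¹) := by
    rintro ⟨a, b⟩ hp
    rw [HasAntidiagonal.mem_antidiagonal] at hp
    simp only at hp ⊢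
    subst hp
    rcases b with _ | b
    · simp only [cqMajorant, if_true, Nat.cast_zero, inv_zero, add_zero, mul_zero]
      refine mul_le_mul_of_nonneg_left ?_ (by positivity)
      have : 0 ≤ ((a : ℝ) + 1)⁻¹ := by positivity
      linarith
    · have := rpow_neg_mul_inv_le hβ0 hβ1 (show (0 : ℝ) < a + 1 by positivity)
        (show (0 : ℝ) < (b + 1 : ℕ) by positivity)
      simp only [cqMajorant, if_neg (Nat.succ_ne_zero b), zero_add]
      refine this.trans_eq ?_
      push_cast
      ring_nf
  have h1 : ∑ p ∈ antidiagonal m, ((if p.2 = 0 then 1 else 0 : ℝ)) = 1 := by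
    rw [← Nat.sum_antidiagonal_swap, Nat.sum_antidiagonal_eq_sum_range_succ_mk, sum_range_succ']
    simp
  have h2 : ∑ p ∈ antidiagonal m, (p.2 : ℝ)⁻¹ ≤ 1 + Real.log (m + 1) := by
    rw [← Nat.sum_antidiagonal_swap, Nat.sum_antidiagonal_eq_sum_range_succ_mk, sum_range_succ']
    have := hharm m
    simp only [Prod.snd_swap, Nat.cast_zero, inv_zero, add_zero, Nat.cast_add, Nat.cast_one]
    rcases Nat.eq_zero_or_pos m with rfl | hm
    · simp
    · exact this.trans (add_le_add_right (Real.log_le_log (by positivity) (by linarith)) _)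
  have h3 : ∑ p ∈ antidiagonal m, ((p.1 : ℝ) + 1)⁻¹ ≤ 1 + Real.log (m + 1) := by
    rw [Nat.sum_antidiagonal_eq_sum_range_succ_mk]
    simpa using hharm (m + 1)
  refine (sum_le_sum hpt).trans ?_
  rw [← mul_sum, sum_add_distrib, sum_add_distrib, ← mul_sum, h1, mul_comm]
  refine mul_le_mul_of_nonneg_right ?_ (by positivity)
  linarith

/-- Convolution with `1, 1, 1 / 2, 1 / 3, …` is bounded in the weighted `ℓ¹` norm up to a
logarithmic factor. -/
theorem weighted_sum_le_of_le_convolution {β : ℝ} (hβ0 : 0 ≤ β) (hβ1 : β ≤ 1) {n : ℕ}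
    (hn : 1 ≤ n) {x s : ℕ → ℝ} (hs : ∀ j, 0 ≤ s j)
    (hxs : ∀ j, x j ≤ ∑ p ∈ antidiagonal j, cqMajorant p.1 * s p.2) :
    ∑ p ∈ antidiagonal n, ((p.1 : ℝ) + 1) ^ (-β) * x p.2 ≤
      9 * Real.log (1 + n) * ∑ p ∈ antidiagonal n, ((p.1 : ℝ) + 1) ^ (-β) * s p.2 := by
  have hlog : 4 + 3 * Real.log (n + 1) ≤ 9 * Real.log (1 + n) := by
    have hn' : (1 : ℝ) ≤ n := by exact_mod_cast hn
    have h1 : Real.log 2 ≤ Real.log (n + 1) := Real.log_le_log (by norm_num) (by linarith)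
    rw [add_comm 1 (n : ℝ)]
    linarith [Real.log_two_gt_d9]
  calc _ ≤ ∑ p ∈ antidiagonal n, ∑ q ∈ antidiagonal p.2,
        ((p.1 : ℝ) + 1) ^ (-β) * cqMajorant q.1 * s q.2 := by
        refine sum_le_sum fun p _ => ?_
        simp only [mul_assoc]
        rw [← mul_sum]
        exact mul_le_mul_of_nonneg_left (hxs _) (by positivity)
    _ = ∑ p ∈ antidiagonal n, (∑ q ∈ antidiagonal p.1,
        ((q.1 : ℝ) + 1) ^ (-β) * cqMajorant q.2) * s p.2 := by
        rw [Nat.sum_antidiagonal_fst_snd fun i j k =>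
          ((i : ℝ) + 1) ^ (-β) * cqMajorant j * s k]
        simp only [sum_mul]
    _ ≤ _ := by
        rw [mul_sum]
        refine sum_le_sum fun p hp => ?_
        rw [← mul_assoc]
        refine mul_le_mul_of_nonneg_right ?_ (hs _)
        refine (sum_rpow_mul_cqMajorant_le hβ0 hβ1 _).trans ?_
        refine mul_le_mul_of_nonneg_right (le_trans ?_ hlog) (by positivity)
        have hpn : (p.1 : ℝ) ≤ n := by
          have := HasAntidiagonal.mem_antidiagonal.mp hp
          exact_mod_cast (by omega : p.1 ≤ n)
        gcongr

theorem sum_Icc_rpow_eq_sum_antidiagonal (γ : ℝ) {τ : ℝ} (hτ : 0 < τ) (n : ℕ) {f : ℕ → ℝ}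
    (hf : f 0 = 0) :
    ∑ j ∈ Icc 1 n, (((n : ℝ) + 1) * τ - (j : ℝ) * τ) ^ γ * f j =
      τ ^ γ * ∑ p ∈ antidiagonal n, ((p.1 : ℝ) + 1) ^ γ * f p.2 := by
  rw [← Nat.sum_antidiagonal_swap, Nat.sum_antidiagonal_eq_sum_range_succ_mk, mul_sum,
    Nat.succ_eq_add_one, sum_range_succ', ← Ico_add_one_right_eq_Icc, sum_Ico_eq_sum_range]
  simp only [Prod.fst_swap, Prod.snd_swap, hf, mul_zero, add_zero, add_tsub_cancel_right]
  refine sum_congr rfl fun k hk => ?_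
  rw [mem_range] at hk
  rw [← mul_assoc, ← Real.mul_rpow hτ.le (by positivity), add_comm 1 k, Nat.cast_sub (by omega)]
  congr 2
  ring

end ConvolutionQuadrature

/-- Weighted stability estimate for the backward Euler CQ scheme in the weighted norm
`|ψ| = ‖(I + τ^α A)^{1/2} ψ‖`. -/
theorem weighted_stability (α : ℝ) (hα0 : 0 < α) (hα1 : α < 1) :
    ∃ c : ℝ, 0 < c ∧
      ∀ (V : Type) (_ : NormedAddCommGroup V) (_ : InnerProductSpace ℂ V)
        (_ : FiniteDimensional ℂ V) (_ : Nontrivial V)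
        (A : V →L[ℂ] V), IsSelfAdjoint A →
        (∀ x : V, x ≠ 0 → 0 < (⟪A x, x⟫).re) →
        ∀ τ : ℝ, 0 < τ → ∀ N : ℕ, 1 ≤ N → ∀ (σ e : ℕ → V), e 0 = 0 →
        (∀ n : ℕ, 1 ≤ n → n ≤ N → cqDeriv α τ e n + A (e n) = σ n) →
        ∀ n : ℕ, 1 ≤ n → n ≤ N →
          τ * ∑ j ∈ Finset.Icc 1 n, (((n : ℝ) + 1) * τ - (j : ℝ) * τ) ^ (α / 2 - 1)
              * ‖shiftPow A τ α (1 / 2) (cqDeriv α τ e j)‖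
          ≤ c * τ * Real.log (1 + (n : ℝ)) * ∑ j ∈ Finset.Icc 1 n,
              (((n : ℝ) + 1) * τ - (j : ℝ) * τ) ^ (α / 2 - 1)
                * ‖shiftPow A τ α (-(1 / 2)) (σ j)‖ := by
  refine ⟨9, by norm_num, ?_⟩
  intro V _ _ _ _ A hsa hpos τ hτ N _ σ e he0 heq n hn hnN
  have hA : 0 ≤ A := by
    rw [ContinuousLinearMap.nonneg_iff_isPositive, ContinuousLinearMap.isPositive_def]
    refine ⟨hsa.isSymmetric, fun x => ?_⟩
    rcases eq_or_ne x 0 with rfl | hx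
    · simp [ContinuousLinearMap.reApplyInnerSelf_apply]
    · exact (hpos x hx).le
  have hD0 : cqDeriv α τ e 0 = 0 := by simp [cqDeriv, he0]
  set s : ℕ → ℝ := fun j => ‖shiftPow A τ α (-(1 / 2)) (cqDeriv α τ e j + A (e j))‖ with hs
  have hs0 : s 0 = 0 := by simp [hs, hD0, he0]
  have hσ : ∀ j ∈ Finset.Icc 1 n, (((n : ℝ) + 1) * τ - (j : ℝ) * τ) ^ (α / 2 - 1) *
      ‖shiftPow A τ α (-(1 / 2)) (σ j)‖ =
      (((n : ℝ) + 1) * τ - (j : ℝ) * τ) ^ (α / 2 - 1) * s j := by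
    intro j hj
    rw [Finset.mem_Icc] at hj
    rw [hs, ← heq j hj.1 (hj.2.trans hnN)]
  have key := weighted_sum_le_of_le_convolution (β := 1 - α / 2) (by linarith) (by linarith) hn
    (x := fun j => ‖shiftPow A τ α (1 / 2) (cqDeriv α τ e j)‖) (s := s)
    (fun j => norm_nonneg _) (norm_shiftPow_cqDeriv_le hA hα0 hα1 hτ e)
  rw [neg_sub] at key
  rw [Finset.sum_congr rfl hσ, sum_Icc_rpow_eq_sum_antidiagonal _ hτ n hs0,
    sum_Icc_rpow_eq_sum_antidiagonal _ hτ n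
      (f := fun j => ‖shiftPow A τ α (1 / 2) (cqDeriv α τ e j)‖) (by simp [hD0])]
  calc _ ≤ τ * (τ ^ (α / 2 - 1) * _) :=
        mul_le_mul_of_nonneg_left (mul_le_mul_of_nonneg_left key (by positivity)) hτ.le
    _ = _ := by ring
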